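/- arXiv:2412.01392 — 2 statements merged into one kernel-verified Lean document; each statement's English description precedes it below -/
import Mathlib

section
/- Let Q be a Gorenstein local ring and Q → R a homomorphism of local rings making R a finitely generated Q-module with pd_Q(R) < ∞. Then a finitely generated Q-module M is totally reflexive over Q if and only if Ext^i_Q(M,R) = 0 for all i > 0. -/
open CategoryTheory

noncomputable section

universe u

variable (R : Type u) [CommRing R]

/-- The `i`-th Ext module of two `R`-modules. -/
abbrev ExtMod (i : ℕ) (M N : ModuleCat.{u} R) : ModuleCat.{u} R :=
  ((Ext R (ModuleCat.{u} R) i).obj (Opposite.op M)).obj N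

/-- The `i`-th Tor module of two `R`-modules. -/
abbrev TorMod (i : ℕ) (M N : ModuleCat.{u} R) : ModuleCat.{u} R :=
  ((Tor' (ModuleCat.{u} R) i).obj M).obj N

/-- `D^⊥`. -/
def perpSet (D : Set (ModuleCat.{u} R)) : Set (ModuleCat.{u} R) :=
  {Y | ∀ X ∈ D, ∀ i : ℕ, 0 < i → Subsingleton (ExtMod R i X Y)}

/-- `E^⊤`. -/
def topSet (E : Set (ModuleCat.{u} R)) : Set (ModuleCat.{u} R) :=
  {X | ∀ Y ∈ E, ∀ i : ℕ, 0 < i → Subsingleton (ExtMod R i X Y)}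

/-- depth via maximal lengths of regular sequences in the maximal ideal. -/
def depth [IsLocalRing R] (M : ModuleCat.{u} R) : ℕ :=
  sSup {n | ∃ rs : List R, rs.length = n ∧ (∀ r ∈ rs, r ∈ IsLocalRing.maximalIdeal R) ∧
    RingTheory.Sequence.IsRegular M rs}

/-- `pd_R M ≤ n` via free syzygies. -/
def ProjDimLE : ℕ → ModuleCat.{u} R → Prop
  | 0, M => Projective M
  | n+1, M => ∃ (K F : ModuleCat.{u} R) (f : K ⟶ F) (g : F ⟶ M) (w : f ≫ g = 0),
      Module.Free R F ∧ (ShortComplex.mk f g w).ShortExact ∧ ProjDimLE n K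

/-- Projective dimension, in `ℕ∞`. -/
def projDim (M : ModuleCat.{u} R) : ℕ∞ :=
  sInf {d : ℕ∞ | ∃ n : ℕ, d = n ∧ ProjDimLE R n M}

/-- Totally reflexive modules. -/
def TotallyReflexive (M : ModuleCat.{u} R) : Prop :=
  Function.Bijective (Module.Dual.eval R M) ∧
  (∀ i : ℕ, 0 < i → Subsingleton (ExtMod R i M (ModuleCat.of R R))) ∧
  (∀ i : ℕ, 0 < i → Subsingleton (ExtMod R i (ModuleCat.of R (Module.Dual R M)) (ModuleCat.of R R)))

/-- `G-dim_R M ≤ n` via syzygies. -/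
def GdimLE : ℕ → ModuleCat.{u} R → Prop
  | 0, M => TotallyReflexive R M
  | n+1, M => ∃ (K F : ModuleCat.{u} R) (f : K ⟶ F) (g : F ⟶ M) (w : f ≫ g = 0),
      Module.Free R F ∧ (ShortComplex.mk f g w).ShortExact ∧ GdimLE n K

/-- Gorenstein dimension, in `ℕ∞`. -/
def Gdim (M : ModuleCat.{u} R) : ℕ∞ :=
  sInf {d : ℕ∞ | ∃ n : ℕ, d = n ∧ GdimLE R n M}

/-- `M` is an `n`-th syzygy module. -/
def IsNthSyzygy : ℕ → ModuleCat.{u} R → Prop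
  | 0, _ => True
  | n+1, M => ∃ (F C : ModuleCat.{u} R) (f : M ⟶ F) (g : F ⟶ C) (w : f ≫ g = 0),
      Module.Free R F ∧ (ShortComplex.mk f g w).ShortExact ∧ IsNthSyzygy n C

/-- `syz_R M`: the largest `t ≤ depth R` such that `M` is a `t`-th syzygy. -/
def syz [IsLocalRing R] (M : ModuleCat.{u} R) : ℕ :=
  sSup {t | t ≤ depth R (ModuleCat.of R R) ∧ IsNthSyzygy R t M}

/-- Complexity of a sequence of natural numbers. -/
def seqComplexity (b : ℕ → ℕ) : ℕ :=
  sInf {r : ℕ | ∃ α : ℝ, ∀ᶠ n in Filter.atTop, (b n : ℝ) ≤ α * (n : ℝ) ^ ((r : ℝ) - 1)}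

/-- Minimal number of generators. -/
def numGen (M : ModuleCat.{u} R) : ℕ :=
  sInf {n | ∃ s : Finset M, s.card = n ∧ Submodule.span R (s : Set M) = ⊤}

/-- Complexity of a pair of modules. -/
def cx (M N : ModuleCat.{u} R) : ℕ :=
  seqComplexity (fun i => numGen R (ExtMod R i M N))

/-- Regular local ring: Noetherian local, maximal ideal generated by a regular sequence. -/
def IsRegularLocal (Q : Type u) [CommRing Q] : Prop :=
  IsLocalRing Q ∧ IsNoetherianRing Q ∧
  ∃ rs : List Q, RingTheory.Sequence.IsRegular Q rs ∧ (Ideal.span {x | x ∈ rs}).IsMaximal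

/-- Local complete intersection ring: the completion is a regular local ring
modulo a regular sequence. -/
def IsCompleteIntersectionLocal (R : Type u) [CommRing R] [IsLocalRing R] : Prop :=
  ∃ (Q : CommRingCat.{u})
    (φ : ↥Q →+* AdicCompletion (IsLocalRing.maximalIdeal R) R),
    IsRegularLocal ↥Q ∧ Function.Surjective φ ∧
    ∃ rs : List ↥Q, RingTheory.Sequence.IsRegular (↥Q) rs ∧
      RingHom.ker φ = Ideal.span {x | x ∈ rs}

/-- Gorenstein local ring: `R` has finite injective dimension over itself,
expressed via eventual vanishing of `Ext^i(-, R)`. -/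
def IsGorensteinLocal (R : Type u) [CommRing R] : Prop :=
  IsLocalRing R ∧ IsNoetherianRing R ∧
  ∃ n : ℕ, ∀ (M : ModuleCat.{u} R) (i : ℕ), n < i → Subsingleton (ExtMod R i M (ModuleCat.of R R))


universe v

/-- The two definitions of `Ext` groups vanish simultaneously in positive degrees. -/
lemma subsingleton_extMod_succ_iff {Q : Type u} [CommRing Q] (M N : ModuleCat.{u} Q) (n : ℕ) :
    Subsingleton (ExtMod Q (n + 1) M N) ↔ Subsingleton (Abelian.Ext M N (n + 1)) := by
  let P := projectiveResolution M
  have h_coh : Subsingleton (ExtMod Q (n + 1) M N) ↔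
      ∀ f : P.complex.X (n + 1) ⟶ N, P.complex.d (n + 2) (n + 1) ≫ f = 0 →
        ∃ g : P.complex.X n ⟶ N, P.complex.d (n + 1) n ≫ g = f := by
    rw [← ModuleCat.isZero_iff_subsingleton, (P.isoExt (n + 1) N).isZero_iff,
      ← HomologicalComplex.exactAt_iff_isZero_homology,
      HomologicalComplex.exactAt_iff' _ n (n + 1) (n + 2) (by simp) (by simp),
      ShortComplex.moduleCat_exact_iff]
    rfl
  rw [h_coh]
  refine ⟨fun h ↦ subsingleton_of_forall_eq 0 fun e ↦ ?_, fun h f hf ↦ ?_⟩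
  · obtain ⟨f, hf, rfl⟩ := P.extMk_surjective e (n + 2) rfl
    exact (P.extMk_eq_zero_iff f (n + 2) rfl hf n rfl).2 (h f hf)
  · exact (P.extMk_eq_zero_iff f (n + 2) rfl hf n rfl).1 (Subsingleton.elim _ _)

lemma forall_subsingleton_extMod_iff {Q : Type u} [CommRing Q] (M N : ModuleCat.{u} Q) :
    (∀ i : ℕ, 0 < i → Subsingleton (ExtMod Q i M N)) ↔
      ∀ i : ℕ, 0 < i → Subsingleton (Abelian.Ext M N i) := by
  refine forall₂_congr fun i hi ↦ ?_
  obtain ⟨n, rfl⟩ := Nat.exists_eq_succ_of_ne_zero hi.ne'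
  exact subsingleton_extMod_succ_iff M N n

lemma ProjDimLE.hasProjectiveDimensionLT {Q : Type u} [CommRing Q] {n : ℕ} {M : ModuleCat.{u} Q}
    (h : ProjDimLE Q n M) : HasProjectiveDimensionLT M (n + 1) := by
  induction n generalizing M with
  | zero => exact projective_iff_hasProjectiveDimensionLT_one.1 h
  | succ n ih =>
    obtain ⟨K, F, f, g, w, hF, hS, hK⟩ := h
    have hP : Projective F := inferInstance
    exact (hS.hasProjectiveDimensionLT_X₃_iff n hP).2 (ih hK)

lemma exists_hasProjectiveDimensionLT_of_projDim_ne_top {Q : Type u} [CommRing Q]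
    {M : ModuleCat.{u} Q} (h : projDim Q M ≠ ⊤) : ∃ n, HasProjectiveDimensionLT M n := by
  by_contra! hc
  refine h (sInf_eq_top.2 ?_)
  rintro _ ⟨n, rfl, hn⟩
  exact absurd hn.hasProjectiveDimensionLT (hc _)

/-- The identity of a finitely generated projective module factors as a sum of endomorphisms
factoring through the ring. -/
lemma exists_dual_basis {Q : Type u} [CommRing Q] (P : ModuleCat.{u} Q) [Module.Finite Q P]
    [Projective P] : ∃ (r : ℕ) (a : Fin r → (P ⟶ ModuleCat.of Q Q))
      (b : Fin r → (ModuleCat.of Q Q ⟶ P)), ∑ j, a j ≫ b j = 𝟙 P := by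
  have : Module.Projective Q P := (IsProjective.iff_projective P).2 inferInstance
  obtain ⟨r, f, hf⟩ := Module.Finite.exists_fin' Q P
  obtain ⟨g, hg⟩ := Module.projective_lifting_property f LinearMap.id hf
  refine ⟨r, fun j ↦ ModuleCat.ofHom (LinearMap.proj j ∘ₗ g),
    fun j ↦ ModuleCat.ofHom (f ∘ₗ LinearMap.single Q (fun _ ↦ Q) j), ?_⟩
  ext x
  have hx : f (g x) = x := LinearMap.congr_fun hg x
  simp only [ModuleCat.hom_sum, LinearMap.sum_apply]
  conv_rhs => rw [ModuleCat.hom_id, LinearMap.id_apply, ← hx,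
    ← LinearMap.sum_single_apply (fun _ ↦ Q) (g x), map_sum]
  rfl

lemma ext_eq_sum_of_dual_basis {Q : Type u} [CommRing Q] {M P : ModuleCat.{u} Q} {i r : ℕ}
    {a : Fin r → (P ⟶ ModuleCat.of Q Q)} {b : Fin r → (ModuleCat.of Q Q ⟶ P)}
    (hab : ∑ j, a j ≫ b j = 𝟙 P) (e : Abelian.Ext M P i) :
    e = ∑ j, (e.comp (Abelian.Ext.mk₀ (a j)) (add_zero i)).comp
      (Abelian.Ext.mk₀ (b j)) (add_zero i) := by
  conv_lhs => rw [← e.comp_mk₀_id, ← hab, Abelian.Ext.mk₀_sum, Abelian.Ext.comp_sum]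
  simp

lemma subsingleton_ext_projective {Q : Type u} [CommRing Q] {M P : ModuleCat.{u} Q}
    [Module.Finite Q P] [Projective P] {i : ℕ}
    (h : Subsingleton (Abelian.Ext M (ModuleCat.of Q Q) i)) : Subsingleton (Abelian.Ext M P i) := by
  obtain ⟨r, a, b, hab⟩ := exists_dual_basis P
  refine subsingleton_of_forall_eq 0 fun e ↦ ?_
  rw [ext_eq_sum_of_dual_basis hab e]
  refine Finset.sum_eq_zero fun j _ ↦ ?_
  rw [Subsingleton.elim (e.comp (Abelian.Ext.mk₀ (a j)) (add_zero i)) 0, Abelian.Ext.zero_comp]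

lemma subsingleton_ext_of_hasProjectiveDimensionLT {Q : Type u} [CommRing Q] [IsNoetherianRing Q]
    {M : ModuleCat.{u} Q} {t : ℕ}
    (h : ∀ i, t ≤ i → Subsingleton (Abelian.Ext M (ModuleCat.of Q Q) i))
    (n : ℕ) (N : ModuleCat.{u} Q) [Module.Finite Q N] (hN : HasProjectiveDimensionLT N n)
    (i : ℕ) (hi : t ≤ i) : Subsingleton (Abelian.Ext M N i) := by
  induction n generalizing N i with
  | zero =>
    have hz := isZero_of_hasProjectiveDimensionLT_zero N
    refine subsingleton_of_forall_eq 0 fun e ↦ ?_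
    rw [← e.comp_mk₀_id, hz.eq_of_src (𝟙 N) 0, Abelian.Ext.mk₀_zero, Abelian.Ext.comp_zero]
  | succ n ih =>
    match n with
    | 0 =>
      have : Projective N := projective_iff_hasProjectiveDimensionLT_one.2 hN
      exact subsingleton_ext_projective (h i hi)
    | n + 1 =>
      obtain ⟨_, _, _, _, _, f, hf⟩ := Module.exists_finite_presentation Q N
      have hS := LinearMap.shortExact_shortComplexKer hf
      have h₁ := ih f.shortComplexKer.X₁ ((hS.hasProjectiveDimensionLT_X₃_iff n inferInstance).1 hN)
        (i + 1) (by lia)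
      have h₂ : Subsingleton (Abelian.Ext M f.shortComplexKer.X₂ i) :=
        subsingleton_ext_projective (h i hi)
      refine subsingleton_of_forall_eq 0 fun e ↦ ?_
      obtain ⟨e', rfl⟩ := Abelian.Ext.covariant_sequence_exact₃ M hS e rfl (Subsingleton.elim _ _)
      rw [Subsingleton.elim e' 0, Abelian.Ext.zero_comp]

/-- A finitely generated module over a local ring has a minimal free cover. -/
lemma exists_minimal_free_cover (Q : Type u) (N : Type v) [CommRing Q] [IsLocalRing Q]
    [AddCommGroup N] [Module Q N] [Module.Finite Q N] :
    ∃ (r : ℕ) (f : (Fin r → Q) →ₗ[Q] N), Function.Surjective f ∧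
      ∀ x, f x = 0 → ∀ j, x j ∈ IsLocalRing.maximalIdeal Q := by
  classical
  have hex : ∃ (r : ℕ) (f : (Fin r → Q) →ₗ[Q] N), Function.Surjective f :=
    Module.Finite.exists_fin' Q N
  obtain ⟨f, hf⟩ := Nat.find_spec hex
  have hmin := fun m ↦ Nat.find_min hex (m := m)
  generalize Nat.find hex = r at f hf hmin
  refine ⟨r, f, hf, fun x hx j ↦ ?_⟩
  by_contra hj
  rw [IsLocalRing.mem_maximalIdeal, mem_nonunits_iff, not_not] at hj
  obtain ⟨u, hu⟩ := hj
  obtain _ | r := r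
  · exact j.elim0
  let ι : (Fin r → Q) →ₗ[Q] (Fin (r + 1) → Q) :=
    { toFun := fun y ↦ j.insertNth 0 y
      map_add' := fun y z ↦ by ext k; refine j.succAboveCases ?_ (fun k ↦ ?_) k <;> simp
      map_smul' := fun c y ↦ by ext k; refine j.succAboveCases ?_ (fun k ↦ ?_) k <;> simp }
  refine hmin r (Nat.lt_succ_self r) ⟨f ∘ₗ ι, fun n ↦ ?_⟩
  obtain ⟨z, rfl⟩ := hf n
  refine ⟨fun k ↦ (z - (z j * (u⁻¹ : Qˣ)) • x) (j.succAbove k), ?_⟩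
  have hι : ι (fun k ↦ (z - (z j * (u⁻¹ : Qˣ)) • x) (j.succAbove k)) =
      z - (z j * (u⁻¹ : Qˣ)) • x := by
    ext k
    refine j.succAboveCases ?_ (fun k ↦ ?_) k
    · simp [ι, ← hu, mul_assoc]
    · simp [ι]
  rw [LinearMap.comp_apply, hι, map_sub, map_smul, hx, smul_zero, sub_zero]

/-- Maps into the ring with image in an ideal induce maps on `Ext` with image in the multiples
by that ideal. -/
lemma ext_comp_mem_ideal_smul {Q : Type u} [CommRing Q] {M P : ModuleCat.{u} Q}
    [Module.Finite Q P] [Projective P] {i : ℕ} (I : Ideal Q) (h : P ⟶ ModuleCat.of Q Q)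
    (hI : ∀ x : P, h x ∈ I) (e : Abelian.Ext M P i) :
    e.comp (Abelian.Ext.mk₀ h) (add_zero i) ∈
      (I • ⊤ : Submodule Q (Abelian.Ext M (ModuleCat.of Q Q) i)) := by
  obtain ⟨r, a, b, hab⟩ := exists_dual_basis P
  rw [ext_eq_sum_of_dual_basis hab e, Abelian.Ext.sum_comp]
  refine Submodule.sum_mem _ fun j _ ↦ ?_
  have hj : b j ≫ h = (h (b j (1 : Q)) : Q) • 𝟙 (ModuleCat.of Q Q) := by
    ext
    simp
  rw [Abelian.Ext.comp_assoc_of_third_deg_zero, Abelian.Ext.mk₀_comp_mk₀, hj, Abelian.Ext.mk₀_smul,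
    Abelian.Ext.comp_smul, Abelian.Ext.comp_mk₀_id]
  exact Submodule.smul_mem_smul (hI _) trivial

/-- If `N ≠ 0` has finite projective dimension, the top nonvanishing `Ext M Q` is detected
by `Ext M N`. -/
lemma subsingleton_ext_ring_of_subsingleton_ext {Q : Type u} [CommRing Q] [IsLocalRing Q]
    [IsNoetherianRing Q] {M N : ModuleCat.{u} Q} [Module.Finite Q M] [Module.Finite Q N]
    [Nontrivial N] {n s : ℕ} (hN : HasProjectiveDimensionLT N n)
    (h : ∀ i, s + 1 ≤ i → Subsingleton (Abelian.Ext M (ModuleCat.of Q Q) i))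
    (hs : Subsingleton (Abelian.Ext M N s)) :
    Subsingleton (Abelian.Ext M (ModuleCat.of Q Q) s) := by
  obtain ⟨r, f, hf, hmin⟩ := exists_minimal_free_cover Q N
  have hS := LinearMap.shortExact_shortComplexKer hf
  have : Nonempty (Fin r) := by
    by_contra hr
    rw [not_nonempty_iff] at hr
    exact not_subsingleton N hf.subsingleton
  obtain ⟨j⟩ := this
  obtain ⟨G, _, _, _, _, g, hg⟩ := Module.exists_finite_presentation Q (LinearMap.ker f)
  have hT := LinearMap.shortExact_shortComplexKer hg
  have hN' : HasProjectiveDimensionLT N (n + 2) :=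
    hasProjectiveDimensionLT_of_ge N n (n + 2) (by lia)
  have hK : HasProjectiveDimensionLT f.shortComplexKer.X₁ (n + 1) :=
    (hS.hasProjectiveDimensionLT_X₃_iff n inferInstance).1 hN'
  have hK' : HasProjectiveDimensionLT g.shortComplexKer.X₁ (n + 1) :=
    (hT.hasProjectiveDimensionLT_X₃_iff n inferInstance).1
      (hasProjectiveDimensionLT_of_ge f.shortComplexKer.X₁ (n + 1) (n + 2) (by lia))
  have hL := subsingleton_ext_of_hasProjectiveDimensionLT h _ g.shortComplexKer.X₁ hK'
    (s + 1) le_rfl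
  suffices htop : (⊤ : Submodule Q (Abelian.Ext M (ModuleCat.of Q Q) s)) ≤
      IsLocalRing.maximalIdeal Q • ⊤ by
    have hbot := Submodule.eq_bot_of_le_smul_of_le_jacobson_bot (IsLocalRing.maximalIdeal Q) _
      Module.Finite.fg_top htop (IsLocalRing.maximalIdeal_le_jacobson ⊥)
    exact (Submodule.subsingleton_iff Q).1 (subsingleton_iff_bot_eq_top.1 hbot.symm)
  intro x _
  let ι : ModuleCat.of Q Q ⟶ f.shortComplexKer.X₂ :=
    ModuleCat.ofHom (LinearMap.single Q (fun _ ↦ Q) j)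
  let π : f.shortComplexKer.X₂ ⟶ ModuleCat.of Q Q := ModuleCat.ofHom (LinearMap.proj j)
  have hιπ : ι ≫ π = 𝟙 _ := by ext; simp [ι, π]
  obtain ⟨y, hy⟩ := Abelian.Ext.covariant_sequence_exact₂ M hS
    (x.comp (Abelian.Ext.mk₀ ι) (add_zero s)) (hs.elim _ _)
  obtain ⟨z, rfl⟩ := Abelian.Ext.covariant_sequence_exact₃ M hT y rfl (hL.elim _ _)
  have hx : x = z.comp (Abelian.Ext.mk₀
      (g.shortComplexKer.g ≫ f.shortComplexKer.f ≫ π)) (add_zero s) := by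
    rw [← x.comp_mk₀_id, ← hιπ, ← Abelian.Ext.mk₀_comp_mk₀,
      ← Abelian.Ext.comp_assoc_of_third_deg_zero, ← hy]
    simp
  rw [hx]
  exact ext_comp_mem_ideal_smul (P := g.shortComplexKer.X₂) _ _ (fun w ↦ hmin _ (g w).2 j) z

/-- Vanishing of `Ext M N` in positive degrees for some nonzero `N` of finite projective dimension
forces vanishing of `Ext M Q`. -/
lemma subsingleton_ext_ring_of_forall_subsingleton_ext {Q : Type u} [CommRing Q] [IsLocalRing Q]
    [IsNoetherianRing Q] {M N : ModuleCat.{u} Q} [Module.Finite Q M] [Module.Finite Q N]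
    [Nontrivial N] {d n : ℕ} (hN : HasProjectiveDimensionLT N d)
    (hQ : ∀ i, n < i → Subsingleton (Abelian.Ext M (ModuleCat.of Q Q) i))
    (h : ∀ i, 0 < i → Subsingleton (Abelian.Ext M N i)) (i : ℕ) (hi : 0 < i) :
    Subsingleton (Abelian.Ext M (ModuleCat.of Q Q) i) := by
  suffices H : ∀ k i, 0 < i → n < i + k → Subsingleton (Abelian.Ext M (ModuleCat.of Q Q) i) from
    H n i hi (by lia)
  intro k
  induction k with
  | zero => exact fun i _ hn ↦ hQ i hn
  | succ k ih =>
    exact fun i hi hn ↦ subsingleton_ext_ring_of_subsingleton_ext hN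
      (fun i' hi' ↦ ih i' (by lia) (by lia)) (h i hi)

section Dual

variable {Q : Type u} [CommRing Q] {K F M : Type u} [AddCommGroup K] [AddCommGroup F]
  [AddCommGroup M] [Module Q K] [Module Q F] [Module Q M] {f : K →ₗ[Q] F} {g : F →ₗ[Q] M}

/-- The short exact sequence in `ModuleCat` attached to an exact pair of linear maps. -/
lemma shortExact_of_exact (hf : Function.Injective f) (hfg : Function.Exact f g)
    (hg : Function.Surjective g) :
    (ModuleCat.shortComplexOfCompEqZero f g hfg.linearMap_comp_eq_zero).ShortExact where
  exact := (ShortComplex.ShortExact.moduleCat_exact_iff_function_exact _).2 hfg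
  mono_f := (ModuleCat.mono_iff_injective _).2 hf
  epi_g := (ModuleCat.epi_iff_surjective _).2 hg

lemma dualMap_surjective_of_subsingleton_ext (hf : Function.Injective f)
    (hfg : Function.Exact f g) (hg : Function.Surjective g)
    (h : Subsingleton (Abelian.Ext (ModuleCat.of Q M) (ModuleCat.of Q Q) 1)) :
    Function.Surjective f.dualMap := by
  intro φ
  obtain ⟨e, he⟩ := Abelian.Ext.contravariant_sequence_exact₁ (shortExact_of_exact hf hfg hg) _
    (Abelian.Ext.mk₀ (ModuleCat.ofHom φ)) (add_zero 1) (h.elim _ _)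
  obtain ⟨ψ, rfl⟩ := (Abelian.Ext.mk₀_bijective _ _).2 e
  rw [Abelian.Ext.mk₀_comp_mk₀] at he
  exact ⟨ψ.hom, congrArg ModuleCat.Hom.hom ((Abelian.Ext.mk₀_bijective _ _).1 he)⟩

lemma exact_dualMap (hfg : Function.Exact f g) (hg : Function.Surjective g) :
    Function.Exact g.dualMap f.dualMap := by
  intro φ
  refine ⟨fun h ↦ ?_, ?_⟩
  · have hle : LinearMap.ker g ≤ LinearMap.ker φ := by
      intro x hx
      obtain ⟨y, rfl⟩ := (hfg x).1 hx
      exact LinearMap.congr_fun h y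
    refine ⟨(LinearMap.ker g).liftQ φ hle ∘ₗ (g.quotKerEquivOfSurjective hg).symm.toLinearMap, ?_⟩
    ext x
    have hx : (g.quotKerEquivOfSurjective hg).symm (g x) = Submodule.Quotient.mk x := by
      rw [LinearEquiv.symm_apply_eq]
      rfl
    simp [LinearMap.dualMap_apply, hx]
  · rintro ⟨ψ, rfl⟩
    ext y
    simp [LinearMap.dualMap_apply, hfg.apply_apply_eq_zero]

end Dual

lemma subsingleton_ext_ker {Q : Type u} [CommRing Q] {F M : Type u} [AddCommGroup F]
    [AddCommGroup M] [Module Q F] [Module Q M] [Module.Projective Q F] {g : F →ₗ[Q] M}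
    (hg : Function.Surjective g) {i : ℕ} (N : ModuleCat.{u} Q) (hi : 0 < i)
    (h : Subsingleton (Abelian.Ext (ModuleCat.of Q M) N (i + 1))) :
    Subsingleton (Abelian.Ext (ModuleCat.of Q (LinearMap.ker g)) N i) := by
  have hS := LinearMap.shortExact_shortComplexKer hg
  have hF : Projective g.shortComplexKer.X₂ := (IsProjective.iff_projective F).1 inferInstance
  obtain ⟨i, rfl⟩ := Nat.exists_eq_succ_of_ne_zero hi.ne'
  refine subsingleton_of_forall_eq 0 fun e ↦ ?_
  obtain ⟨e', rfl⟩ := Abelian.Ext.contravariant_sequence_exact₁ hS N e (add_comm _ _) (h.elim _ _)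
  rw [Abelian.Ext.eq_zero_of_projective e', Abelian.Ext.comp_zero]

lemma subsingleton_ext_dual {Q : Type u} [CommRing Q] [IsNoetherianRing Q] {n : ℕ}
    (hQ : ∀ (M : ModuleCat.{u} Q) (i : ℕ), n < i →
      Subsingleton (Abelian.Ext M (ModuleCat.of Q Q) i))
    (M : Type u) [AddCommGroup M] [Module Q M] [Module.Finite Q M]
    (h : ∀ i, 0 < i → Subsingleton (Abelian.Ext (ModuleCat.of Q M) (ModuleCat.of Q Q) i))
    (i : ℕ) (hi : 0 < i) :
    Subsingleton (Abelian.Ext (ModuleCat.of Q (Module.Dual Q M)) (ModuleCat.of Q Q) i) := by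
  suffices H : ∀ (k i : ℕ) (M : Type u) [AddCommGroup M] [Module Q M] [Module.Finite Q M],
      (∀ i, 0 < i → Subsingleton (Abelian.Ext (ModuleCat.of Q M) (ModuleCat.of Q Q) i)) →
      0 < i → n < i + k →
      Subsingleton (Abelian.Ext (ModuleCat.of Q (Module.Dual Q M)) (ModuleCat.of Q Q) i) from
    H n i M h hi (by lia)
  intro k
  induction k with
  | zero => exact fun i M _ _ _ _ _ hn ↦ hQ _ i hn
  | succ k ih =>
    intro i M _ _ _ h hi hn
    obtain ⟨F, _, _, _, _, g, hg⟩ := Module.exists_finite_presentation Q M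
    have hfg : Function.Exact (LinearMap.ker g).subtype g := LinearMap.exact_subtype_ker_map g
    have hK := ih (i + 1) (LinearMap.ker g)
      (fun j hj ↦ subsingleton_ext_ker hg _ hj (h (j + 1) (by lia))) (by lia) (by lia)
    have hS := shortExact_of_exact (LinearMap.dualMap_injective_of_surjective hg)
      (exact_dualMap hfg hg)
      (dualMap_surjective_of_subsingleton_ext (LinearMap.ker g).injective_subtype hfg hg
        (h 1 one_pos))
    have hF : Projective (ModuleCat.of Q (Module.Dual Q F)) :=
      (IsProjective.iff_projective _).1 inferInstance
    obtain ⟨i, rfl⟩ := Nat.exists_eq_succ_of_ne_zero hi.ne'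
    refine subsingleton_of_forall_eq 0 fun e ↦ ?_
    obtain ⟨e', rfl⟩ := Abelian.Ext.contravariant_sequence_exact₁ hS _ e (add_comm _ _)
      (hK.elim _ _)
    have he' : e' = 0 :=
      Abelian.Ext.eq_zero_of_projective (P := ModuleCat.of Q (Module.Dual Q F)) e'
    rw [he', Abelian.Ext.comp_zero]

lemma dualMap_dualMap_surjective {Q : Type u} [CommRing Q] [IsNoetherianRing Q] {n : ℕ}
    (hQ : ∀ (M : ModuleCat.{u} Q) (i : ℕ), n < i →
      Subsingleton (Abelian.Ext M (ModuleCat.of Q Q) i))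
    {F M : Type u} [AddCommGroup F] [AddCommGroup M] [Module Q F] [Module Q M]
    [Module.Finite Q F] [Module.Projective Q F] {g : F →ₗ[Q] M} (hg : Function.Surjective g)
    (h : ∀ i, 0 < i → Subsingleton (Abelian.Ext (ModuleCat.of Q M) (ModuleCat.of Q Q) i)) :
    Function.Surjective g.dualMap.dualMap := by
  have hfg : Function.Exact (LinearMap.ker g).subtype g := LinearMap.exact_subtype_ker_map g
  exact dualMap_surjective_of_subsingleton_ext (LinearMap.dualMap_injective_of_surjective hg)
      (exact_dualMap hfg hg)
    (dualMap_surjective_of_subsingleton_ext (LinearMap.ker g).injective_subtype hfg hg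
      (h 1 one_pos))
    (subsingleton_ext_dual hQ (LinearMap.ker g)
      (fun j hj ↦ subsingleton_ext_ker hg _ hj (h (j + 1) (by lia))) 1 one_pos)

lemma dual_eval_surjective {Q : Type u} [CommRing Q] [IsNoetherianRing Q] {n : ℕ}
    (hQ : ∀ (M : ModuleCat.{u} Q) (i : ℕ), n < i →
      Subsingleton (Abelian.Ext M (ModuleCat.of Q Q) i))
    (M : Type u) [AddCommGroup M] [Module Q M] [Module.Finite Q M]
    (h : ∀ i, 0 < i → Subsingleton (Abelian.Ext (ModuleCat.of Q M) (ModuleCat.of Q Q) i)) :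
    Function.Surjective (Module.Dual.eval Q M) := by
  obtain ⟨F, _, _, _, _, g, hg⟩ := Module.exists_finite_presentation Q M
  intro ξ
  obtain ⟨η, rfl⟩ := dualMap_dualMap_surjective hQ hg h ξ
  obtain ⟨x, rfl⟩ := (Module.bijective_dual_eval Q F).2 η
  exact ⟨g x, rfl⟩

lemma dual_eval_injective {Q : Type u} [CommRing Q] [IsNoetherianRing Q] {n : ℕ}
    (hQ : ∀ (M : ModuleCat.{u} Q) (i : ℕ), n < i →
      Subsingleton (Abelian.Ext M (ModuleCat.of Q Q) i))
    (M : Type u) [AddCommGroup M] [Module Q M] [Module.Finite Q M]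
    (h : ∀ i, 0 < i → Subsingleton (Abelian.Ext (ModuleCat.of Q M) (ModuleCat.of Q Q) i)) :
    Function.Injective (Module.Dual.eval Q M) := by
  obtain ⟨F, _, _, _, _, g, hg⟩ := Module.exists_finite_presentation Q M
  have hfg : Function.Exact (LinearMap.ker g).subtype g := LinearMap.exact_subtype_ker_map g
  have hexact := exact_dualMap (exact_dualMap hfg hg)
    (dualMap_surjective_of_subsingleton_ext (LinearMap.ker g).injective_subtype hfg hg
      (h 1 one_pos))
  rw [injective_iff_map_eq_zero]
  intro m hm
  obtain ⟨x, rfl⟩ := hg m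
  obtain ⟨η, hη⟩ := (hexact (Module.Dual.eval Q F x)).1 hm
  obtain ⟨y, rfl⟩ := dual_eval_surjective hQ (LinearMap.ker g)
    (fun j hj ↦ subsingleton_ext_ker hg _ hj (h (j + 1) (by lia))) η
  have hxy : (y : F) = x := (Module.bijective_dual_eval Q F).1 hη
  rw [← hxy]
  exact y.2

theorem stmt5 (Q R : Type u) [CommRing Q] [CommRing R] [IsLocalRing Q] [IsLocalRing R]
    [Algebra Q R] [Module.Finite Q R]
    (hQ : IsGorensteinLocal Q) (hloc : IsLocalHom (algebraMap Q R))
    (hpd : projDim Q (ModuleCat.of Q R) ≠ ⊤)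
    (M : ModuleCat.{u} Q) (hM : Module.Finite Q M) :
    TotallyReflexive Q M ↔
      ∀ i : ℕ, 0 < i → Subsingleton (ExtMod Q i M (ModuleCat.of Q R)) := by
  obtain ⟨-, hQN, n, hn⟩ := hQ
  have hExt (L : ModuleCat.{u} Q) (i : ℕ) (hi : n < i) :
      Subsingleton (Abelian.Ext L (ModuleCat.of Q Q) i) := by
    obtain ⟨i, rfl⟩ := Nat.exists_eq_succ_of_ne_zero (Nat.ne_zero_of_lt hi)
    exact (subsingleton_extMod_succ_iff L _ i).1 (hn L _ hi)
  obtain ⟨d, hd⟩ := exists_hasProjectiveDimensionLT_of_projDim_ne_top hpd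
  rw [TotallyReflexive, forall_subsingleton_extMod_iff, forall_subsingleton_extMod_iff,
    forall_subsingleton_extMod_iff]
  refine ⟨fun h ↦ subsingleton_ext_of_hasProjectiveDimensionLT h.2.1 d (ModuleCat.of Q R) hd,
    fun h ↦ ?_⟩
  have hM' := subsingleton_ext_ring_of_forall_subsingleton_ext hd (hExt M) h
  exact ⟨⟨dual_eval_injective hExt M hM', dual_eval_surjective hExt M hM'⟩, hM',
    subsingleton_ext_dual hExt M hM'⟩
end
end

section
/- In the setting of the previous construction (R = Q/(x), M a finitely generated R-module with G-dim_Q(M) < ∞, and 0 → X̃ → G̃ → M → 0 the lifted G(Q)-approximation), if M has locally finite projective dimension on the punctured spectrum of R, then G̃ has locally finite projective dimension on the punctured spectrum of Q. -/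
open CategoryTheory

noncomputable section

universe u

variable (R : Type u) [CommRing R]

/-- `M` has locally finite projective dimension on the punctured spectrum. -/
def LocFinPdPunctured (R : Type u) [CommRing R] [IsLocalRing R] (M : ModuleCat.{u} R) : Prop :=
  ∀ (p : Ideal R) [p.IsPrime], p ≠ IsLocalRing.maximalIdeal R →
    projDim (Localization p.primeCompl)
      (ModuleCat.of (Localization p.primeCompl) (LocalizedModule p.primeCompl M)) ≠ ⊤

section

variable {R}

theorem hasProjectiveDimensionLT_of_projDimLE {n : ℕ} {M : ModuleCat.{u} R}
    (h : ProjDimLE R n M) : HasProjectiveDimensionLT M (n + 1) := by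
  induction n generalizing M with
  | zero =>
    have : Projective M := h
    infer_instance
  | succ n ih =>
    obtain ⟨K, F, f, g, w, hF, hS, hK⟩ := h
    have : Projective F := ModuleCat.projective_of_free (Module.Free.chooseBasis R F)
    exact hS.hasProjectiveDimensionLT_X₃ (n + 1) (ih hK)
      (hasProjectiveDimensionLT_of_ge F 1 (n + 2) (by omega))

theorem projDimLE_of_hasProjectiveDimensionLT {n : ℕ} {M : ModuleCat.{u} R}
    (h : HasProjectiveDimensionLT M (n + 1)) : ProjDimLE R n M := by
  induction n generalizing M with
  | zero => exact projective_iff_hasProjectiveDimensionLT_one.2 h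
  | succ n ih =>
    refine ⟨_, _, M.projectiveShortComplex.f, M.projectiveShortComplex.g,
      M.projectiveShortComplex.zero, ?_, M.shortExact_projectiveShortComplex, ih ?_⟩
    · dsimp [ModuleCat.projectiveShortComplex]
      infer_instance
    · exact (M.shortExact_projectiveShortComplex.hasProjectiveDimensionLT_X₃_iff n
        inferInstance).mp h

theorem projDim_ne_top_iff {M : ModuleCat.{u} R} :
    projDim R M ≠ ⊤ ↔ ∃ n : ℕ, HasProjectiveDimensionLT M n := by
  constructor
  · intro h
    by_contra! hn
    refine h (sInf_eq_top.2 ?_)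
    rintro _ ⟨n, rfl, hP⟩
    exact absurd (hasProjectiveDimensionLT_of_projDimLE hP) (hn _)
  · rintro ⟨n, hn⟩
    have hP : ProjDimLE R n M :=
      projDimLE_of_hasProjectiveDimensionLT (hasProjectiveDimensionLT_of_ge M n (n + 1) (by omega))
    exact ne_top_of_le_ne_top (ENat.natCast_ne_top n) (sInf_le ⟨n, rfl, hP⟩)

section ChangeOfRings

variable {A B : Type u} [CommRing A] [CommRing B] (f : A →+* B)

theorem hasProjectiveDimensionLT_restrictScalars_finsupp (hf : Function.Surjective f) {y : A}
    (hy : y ∈ nonZeroDivisors A) (hker : RingHom.ker f = Ideal.span {y}) (I : Type u) :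
    HasProjectiveDimensionLT
      ((ModuleCat.restrictScalars f).obj (ModuleCat.of B (I →₀ B))) 2 := by
  let P := ModuleCat.of A (I →₀ A)
  let N := (ModuleCat.restrictScalars f).obj (ModuleCat.of B (I →₀ B))
  have hP : Projective P := ModuleCat.projective_of_free (Module.Free.chooseBasis A P)
  let g : P →ₗ[A] N :=
    { toFun := fun c => Finsupp.mapRange f (map_zero f) (c : I →₀ A)
      map_add' := fun c d => by
        refine Finsupp.ext fun i => ?_
        exact map_add f ((c : I →₀ A) i) ((d : I →₀ A) i)
      map_smul' := fun r c => by
        refine Finsupp.ext fun i => ?_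
        exact map_mul f r ((c : I →₀ A) i) }
  have hfy : f y = 0 := by
    rw [← RingHom.mem_ker, hker]; exact Ideal.mem_span_singleton_self y
  have w : ModuleCat.ofHom (LinearMap.lsmul A P y) ≫ ModuleCat.ofHom g = 0 := by
    refine ModuleCat.hom_ext (LinearMap.ext fun c => ?_)
    refine Finsupp.ext (M := B) fun i => ?_
    change f (y * (c : I →₀ A) i) = 0
    rw [map_mul, hfy, zero_mul]
  have hS : (ShortComplex.mk _ _ w).ShortExact := by
    refine ShortComplex.ShortExact.mk' ?_ ?_ ?_
    · rw [ShortComplex.ShortExact.moduleCat_exact_iff_function_exact]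
      intro c
      constructor
      · intro hc
        have hc' : ∀ i, ∃ d, y * d = (c : I →₀ A) i := fun i => by
          have h0 : f ((c : I →₀ A) i) = 0 := DFunLike.congr_fun (F := I →₀ B) hc i
          rw [← RingHom.mem_ker, hker, Ideal.mem_span_singleton] at h0
          obtain ⟨d, hd⟩ := h0
          exact ⟨d, hd.symm⟩
        choose d hd using hc'
        refine ⟨Finsupp.onFinset (c : I →₀ A).support d fun i hi => ?_, ?_⟩
        · rw [Finsupp.mem_support_iff, ← hd i]
          intro h0
          rw [mul_comm] at h0
          exact hi ((mem_nonZeroDivisors_iff.1 hy).2 _ h0)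
        · exact Finsupp.ext hd
      · rintro ⟨d, rfl⟩
        exact ConcreteCategory.congr_hom w d
    · rw [ModuleCat.mono_iff_injective]
      intro c d h
      refine Finsupp.ext fun i => ?_
      have h1 : y * (c : I →₀ A) i = y * (d : I →₀ A) i := DFunLike.congr_fun (F := I →₀ A) h i
      exact (mul_cancel_left_mem_nonZeroDivisors hy).1 h1
    · rw [ModuleCat.epi_iff_surjective]
      exact Finsupp.mapRange_surjective f (map_zero f) hf
  exact hS.hasProjectiveDimensionLT_X₃ 1 inferInstance inferInstance

theorem hasProjectiveDimensionLT_restrictScalars (hf : Function.Surjective f) {y : A}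
    (hy : y ∈ nonZeroDivisors A) (hker : RingHom.ker f = Ideal.span {y}) {n : ℕ}
    {M : ModuleCat.{u} B} (hM : HasProjectiveDimensionLT M (n + 1)) :
    HasProjectiveDimensionLT ((ModuleCat.restrictScalars f).obj M) (n + 2) := by
  induction n generalizing M with
  | zero =>
    have : Projective M := projective_iff_hasProjectiveDimensionLT_one.2 hM
    let g : ModuleCat.of B (M →₀ B) ⟶ M := ModuleCat.ofHom (Finsupp.linearCombination B id)
    have : Epi g := (ModuleCat.epi_iff_surjective _).2
      (Finsupp.linearCombination_id_surjective B M)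
    let r : Retract M (ModuleCat.of B (M →₀ B)) :=
      { i := Projective.factorThru (𝟙 M) g
        r := g
        retract := Projective.factorThru_comp _ _ }
    have := hasProjectiveDimensionLT_restrictScalars_finsupp f hf hy hker M
    exact (r.map (ModuleCat.restrictScalars f)).hasProjectiveDimensionLT 2
  | succ n ih =>
    have hS := LinearMap.shortExact_shortComplexKer (Finsupp.linearCombination_id_surjective B M)
    have hP : Projective (Finsupp.linearCombination B (id : M → M)).shortComplexKer.X₂ :=
      ModuleCat.projective_of_free (Module.Free.chooseBasis B (M →₀ B))
    have h₁ := (hS.hasProjectiveDimensionLT_X₃_iff n hP).mp hM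
    have h₂ := hasProjectiveDimensionLT_restrictScalars_finsupp f hf hy hker M
    have h₃ := @hasProjectiveDimensionLT_of_ge _ _ _ _ 2 (n + 3) (by omega) h₂
    exact (hS.map_of_exact (ModuleCat.restrictScalars f)).hasProjectiveDimensionLT_X₃ (n + 2)
      (ih h₁) h₃

theorem nonempty_localizedModule_linearEquiv [Algebra A B] (S : Submonoid A) {M N : Type u}
    [AddCommGroup M] [Module A M] [Module B M] [IsScalarTower A B M]
    [AddCommGroup N] [Module A N] [Module B N] [IsScalarTower A B N]
    [Module (Localization S) N] [IsScalarTower A (Localization S) N] (g : M →ₗ[B] N)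
    [IsLocalizedModule (Algebra.algebraMapSubmonoid B S) g] :
    Nonempty (N ≃ₗ[Localization S] LocalizedModule S M) :=
  have := IsLocalizedModule.restrictScalars S g
  ⟨((IsLocalizedModule.iso S (g.restrictScalars A)).extendScalarsOfIsLocalization S
    (Localization S)).symm⟩

theorem nonempty_iso_localizedModule_restrictScalars (S : Submonoid A) (T : Submonoid B)
    (hT : S.map f = T) (M : ModuleCat.{u} B) :
    Nonempty ((ModuleCat.restrictScalars (IsLocalization.map (Localization T) f
        (hT.symm ▸ S.le_comap_map) : Localization S →+* Localization T)).obj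
          (ModuleCat.of (Localization T) (LocalizedModule T M)) ≅
      ModuleCat.of (Localization S)
        (LocalizedModule S ((ModuleCat.restrictScalars f).obj M))) := by
  let F : Localization S →+* Localization T :=
    IsLocalization.map (Localization T) f (hT.symm ▸ S.le_comap_map)
  let N := (ModuleCat.restrictScalars F).obj
    (ModuleCat.of (Localization T) (LocalizedModule T M))
  let M' := (ModuleCat.restrictScalars f).obj M
  let : Algebra A B := f.toAlgebra
  let : Module B M' := inferInstanceAs (Module B M)
  have : IsScalarTower A B M' := IsScalarTower.of_algebraMap_smul fun _ _ => rfl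
  let : Module B N := inferInstanceAs (Module B (LocalizedModule T M))
  let : Module A N := Module.compHom N f
  have : IsScalarTower A B N := IsScalarTower.of_algebraMap_smul fun _ _ => rfl
  have : IsScalarTower A (Localization S) N := by
    refine IsScalarTower.of_algebraMap_smul fun r z => ?_
    have h : F (algebraMap A (Localization S) r) = algebraMap B (Localization T) (f r) :=
      IsLocalization.map_eq _ r
    exact (congrArg (fun c => (c • (show LocalizedModule T M from z) : LocalizedModule T M)) h).trans
      (algebraMap_smul (Localization T) (f r) (show LocalizedModule T M from z))
  let g : M' →ₗ[B] N := LocalizedModule.mkLinearMap T M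
  have : IsLocalizedModule (Algebra.algebraMapSubmonoid B S) g := by
    have h : Algebra.algebraMapSubmonoid B S = T := hT
    rw [h]
    exact inferInstanceAs (IsLocalizedModule T (LocalizedModule.mkLinearMap T M))
  obtain ⟨e⟩ := nonempty_localizedModule_linearEquiv S g
  exact ⟨e.toModuleIso⟩

theorem hasProjectiveDimensionLT_localizedModule_restrictScalars (hf : Function.Surjective f)
    {y : A} (hy : y ∈ nonZeroDivisors A) (hker : RingHom.ker f = Ideal.span {y})
    (S : Submonoid A) (T : Submonoid B) (hT : S.map f = T) {n : ℕ} {M : ModuleCat.{u} B}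
    (hM : HasProjectiveDimensionLT
      (ModuleCat.of (Localization T) (LocalizedModule T M)) (n + 1)) :
    HasProjectiveDimensionLT (ModuleCat.of (Localization S)
      (LocalizedModule S ((ModuleCat.restrictScalars f).obj M))) (n + 2) := by
  obtain ⟨e⟩ := nonempty_iso_localizedModule_restrictScalars f S T hT M
  have hsurj : Function.Surjective (IsLocalization.map (Localization T) f
      (hT.symm ▸ S.le_comap_map) : Localization S →+* Localization T) := by
    subst hT
    exact IsLocalization.map_surjective_of_surjective S (Localization S) _ hf
  have hy' : algebraMap A (Localization S) y ∈ nonZeroDivisors (Localization S) :=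
    IsLocalization.map_nonZeroDivisors_le S (Localization S) (Submonoid.mem_map_of_mem _ hy)
  have hker' : RingHom.ker (IsLocalization.map (Localization T) f
      (hT.symm ▸ S.le_comap_map) : Localization S →+* Localization T) =
      Ideal.span {algebraMap A (Localization S) y} := by
    rw [IsLocalization.ker_map (Localization T) f hT, hker, Ideal.map_span, Set.image_singleton]
  have := hasProjectiveDimensionLT_restrictScalars _ hsurj hy' hker' hM
  exact hasProjectiveDimensionLT_of_iso e (n + 2)

end ChangeOfRings

theorem hasProjectiveDimensionLT_localizedModule_X₂ (S : Submonoid R) {X : ShortComplex (ModuleCat.{u} R)}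
    (hX : X.ShortExact) {n : ℕ}
    (h₁ : HasProjectiveDimensionLT X.X₁ (n + 1))
    (h₃ : HasProjectiveDimensionLT
      (ModuleCat.of (Localization S) (LocalizedModule S X.X₃)) (n + 1)) :
    HasProjectiveDimensionLT
      (ModuleCat.of (Localization S) (LocalizedModule S X.X₂)) (n + 1) := by
  let e (Y : ModuleCat.{u} R) :
      Y.localizedModule S ≅ ModuleCat.of (Localization S) (LocalizedModule S Y) :=
    (Shrink.linearEquiv (Localization S) (LocalizedModule S Y)).toModuleIso
  have h₁' := ModuleCat.localizedModule_hasProjectiveDimensionLE n S X.X₁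
  have h₃' := hasProjectiveDimensionLT_of_iso (e X.X₃).symm (n + 1)
  have h₂ := (hX.map_of_exact (ModuleCat.localizedModuleFunctor S)).hasProjectiveDimensionLT_X₂
    (n + 1) h₁' h₃'
  exact @hasProjectiveDimensionLT_of_iso _ _ _ _ _ (e X.X₂) (n + 1) h₂

end

theorem stmt8 (Q : Type u) [CommRing Q] [IsLocalRing Q] [IsNoetherianRing Q]
    (x : Q) (hx : x ∈ IsLocalRing.maximalIdeal Q) (hreg : x ∈ nonZeroDivisors Q)
    [IsLocalRing (Q ⧸ Ideal.span {x})]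
    (M : ModuleCat.{u} (Q ⧸ Ideal.span {x}))
    (hfg : Module.Finite (Q ⧸ Ideal.span {x}) M)
    (hGQ : Gdim Q ((ModuleCat.restrictScalars (Ideal.Quotient.mk (Ideal.span {x}))).obj M) ≠ ⊤)
    (X' G' : ModuleCat.{u} Q) (a : X' ⟶ G')
    (b : G' ⟶ (ModuleCat.restrictScalars (Ideal.Quotient.mk (Ideal.span {x}))).obj M)
    (w' : a ≫ b = 0)
    (hse : (ShortComplex.mk a b w').ShortExact)
    (hG' : TotallyReflexive Q G') (hX' : projDim Q X' ≠ ⊤)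
    (hMloc : LocFinPdPunctured (Q ⧸ Ideal.span {x}) M) :
    LocFinPdPunctured Q G' := by
  intro p hp hpm
  let φ := Ideal.Quotient.mk (Ideal.span {x})
  have hφ : Function.Surjective φ := Ideal.Quotient.mk_surjective
  have hker : RingHom.ker φ = Ideal.span {x} := Ideal.mk_ker
  rw [projDim_ne_top_iff]
  obtain ⟨k, hk⟩ := projDim_ne_top_iff.1 hX'
  have hM : ∃ n, HasProjectiveDimensionLT (ModuleCat.of (Localization p.primeCompl)
      (LocalizedModule p.primeCompl ((ModuleCat.restrictScalars φ).obj M))) n := by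
    by_cases hxp : x ∈ p
    · have hle : RingHom.ker φ ≤ p := by
        rwa [hker, Ideal.span_singleton_le_iff_mem]
      have hq : (p.map φ).IsPrime := Ideal.map_isPrime_of_surjective hφ hle
      have hcomap : (p.map φ).comap φ = p := by
        rw [Ideal.comap_map_of_surjective φ hφ, ← RingHom.ker_eq_comap_bot, sup_of_le_left hle]
      have hqm : p.map φ ≠ IsLocalRing.maximalIdeal _ := by
        intro h
        have hmax := Ideal.comap_isMaximal_of_surjective φ hφ
          (K := IsLocalRing.maximalIdeal (Q ⧸ Ideal.span {x}))
        rw [← h, hcomap] at hmax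
        exact hpm (IsLocalRing.eq_maximalIdeal hmax)
      obtain ⟨n, hn⟩ := projDim_ne_top_iff.1 (hMloc (p.map φ) hqm)
      have hT : p.primeCompl.map φ = (p.map φ).primeCompl := by
        ext z
        constructor
        · rintro ⟨s, hs, rfl⟩ hz
          exact hs (hcomap ▸ Ideal.mem_comap.2 hz)
        · intro hz
          obtain ⟨s, rfl⟩ := hφ z
          exact ⟨s, fun hs => hz (Ideal.mem_map_of_mem φ hs), rfl⟩
      exact ⟨n + 2, hasProjectiveDimensionLT_localizedModule_restrictScalars φ hφ hreg hker
        p.primeCompl _ hT (hasProjectiveDimensionLT_of_ge _ n (n + 1) (by omega))⟩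
    · refine ⟨0, Limits.IsZero.hasProjectiveDimensionLT_zero ?_⟩
      rw [ModuleCat.isZero_iff_subsingleton]
      refine LocalizedModule.subsingleton_iff.2 fun m => ⟨x, hxp, ?_⟩
      change φ x • (m : M) = 0
      rw [Ideal.Quotient.eq_zero_iff_mem.2 (Ideal.mem_span_singleton_self x), zero_smul]
  obtain ⟨l, hl⟩ := hM
  exact ⟨k + l + 1, hasProjectiveDimensionLT_localizedModule_X₂ p.primeCompl hse
    (hasProjectiveDimensionLT_of_ge _ k _ (by omega))
    (hasProjectiveDimensionLT_of_ge _ l _ (by omega))⟩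

end
end
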